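/- Let m ≥ 4 and let B be an adjacency basis of the cycle C_m. Then: (1) every gap of B contains at most three vertices; (2) at most one gap of B contains three vertices; (3) if a gap of B contains at least two vertices, then every gap neighboring it contains exactly one vertex. -/

import Mathlib

open SimpleGraph

/-- `W` is an adjacency resolving set for `G`: distinct vertices have distinct
vectors of truncated distances `min 2 (d(·,w))`, `w ∈ W`. -/
def IsAdjResolving {α : Type*} (G : SimpleGraph α) (W : Set α) : Prop :=
  ∀ u v : α, (∀ w ∈ W, min 2 (G.dist u w) = min 2 (G.dist v w)) → u = v

/-- The adjacency dimension of `G`. -/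
noncomputable def adjDim {α : Type*} [Fintype α] (G : SimpleGraph α) : ℕ :=
  sInf {k | ∃ W : Finset α, W.card = k ∧ IsAdjResolving G ↑W}

/-- `B` is an adjacency basis of `G`: an adjacency resolving set of minimum
cardinality. -/
def IsAdjBasis {α : Type*} [Fintype α] (G : SimpleGraph α) (B : Finset α) : Prop :=
  IsAdjResolving G ↑B ∧ B.card = adjDim G

/-- `Q` is a gap of the vertex set `S` in `G`: the vertex set of a (nonempty)
connected component of the subgraph induced on the complement of `S`. -/
def IsGap {α : Type*} (G : SimpleGraph α) (S : Set α) (Q : Set α) : Prop :=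
  ∃ c : (G.induce Sᶜ).ConnectedComponent, Q = Subtype.val '' c.supp

/-- Two gaps `Q₁ ≠ Q₂` of `S` are neighboring if some `x ∈ S` makes the subgraph
induced on `Q₁ ∪ Q₂ ∪ {x}` connected. -/
def NeighboringGaps {α : Type*} (G : SimpleGraph α) (S : Set α) (Q₁ Q₂ : Set α) : Prop :=
  Q₁ ≠ Q₂ ∧ ∃ x ∈ S, (G.induce (Q₁ ∪ Q₂ ∪ {x})).Connected

theorem IsAdjResolving.eq_of_adj_iff {α : Type*} {G : SimpleGraph α} {W : Set α}
    (hW : IsAdjResolving G W) (hG : G.Connected) {u v : α} (hu : u ∉ W) (hv : v ∉ W)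
    (h : ∀ w ∈ W, G.Adj u w ↔ G.Adj v w) : u = v := by
  refine hW u v fun w hw => ?_
  have hu0 : G.dist u w ≠ 0 := fun h0 => hu ((hG.dist_eq_zero_iff.mp h0) ▸ hw)
  have hv0 : G.dist v w ≠ 0 := fun h0 => hv ((hG.dist_eq_zero_iff.mp h0) ▸ hw)
  have huv : G.dist u w = 1 ↔ G.dist v w = 1 := by
    simpa only [dist_eq_one_iff_adj] using h w hw
  omega

namespace IsGap

variable {α : Type*} {G : SimpleGraph α} {S Q Q₁ Q₂ : Set α}

theorem nonempty (hQ : IsGap G S Q) : Q.Nonempty := by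
  obtain ⟨c, rfl⟩ := hQ
  exact c.nonempty_supp.image _

theorem notMem (hQ : IsGap G S Q) {v : α} (hv : v ∈ Q) : v ∉ S := by
  obtain ⟨c, rfl⟩ := hQ
  obtain ⟨w, -, rfl⟩ := hv
  exact w.2

theorem mem_of_adj (hQ : IsGap G S Q) {u v : α} (hu : u ∈ Q) (huv : G.Adj u v) (hv : v ∉ S) :
    v ∈ Q := by
  obtain ⟨c, rfl⟩ := hQ
  obtain ⟨w, hw, rfl⟩ := hu
  have hadj : (G.induce Sᶜ).Adj w ⟨v, hv⟩ := huv
  exact ⟨⟨v, hv⟩, c.mem_supp_of_adj_mem_supp hw hadj, rfl⟩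

theorem subset_of_closed (hQ : IsGap G S Q) {T : Set α} {q : α} (hq : q ∈ Q) (hqT : q ∈ T)
    (hT : ∀ u ∈ T, ∀ v, G.Adj u v → v ∉ S → v ∈ T) : Q ⊆ T := by
  obtain ⟨c, rfl⟩ := hQ
  obtain ⟨x, hx, rfl⟩ := hq
  rintro _ ⟨y, hy, rfl⟩
  obtain ⟨p⟩ := ConnectedComponent.exact (hx.trans hy.symm)
  clear hx hy
  induction p with
  | nil => exact hqT
  | @cons _ v _ h _ ih => exact ih (hT _ hqT _ h v.2)

theorem eq_of_mem (hQ₁ : IsGap G S Q₁) (hQ₂ : IsGap G S Q₂) {v : α} (h₁ : v ∈ Q₁)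
    (h₂ : v ∈ Q₂) : Q₁ = Q₂ :=
  (hQ₁.subset_of_closed h₁ h₂ fun _ hu _ huv hv => hQ₂.mem_of_adj hu huv hv).antisymm
    (hQ₂.subset_of_closed h₂ h₁ fun _ hu _ huv hv => hQ₁.mem_of_adj hu huv hv)

theorem exists_adj_mem (hQ : IsGap G S Q) (hcard : 2 ≤ Q.ncard) {q : α} (hq : q ∈ Q) :
    ∃ r ∈ Q, G.Adj q r := by
  by_contra! h
  have hsub : Q ⊆ {q} := hQ.subset_of_closed hq rfl <| by
    rintro _ rfl v huv hv
    exact absurd huv (h v (hQ.mem_of_adj hq huv hv))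
  have := Set.ncard_le_ncard hsub
  simp at this
  omega

theorem exists_adj_of_connected (hQ₁ : IsGap G S Q₁) (hQ₂ : IsGap G S Q₂)
    {x : α} (hx : x ∈ S) (hconn : (G.induce (Q₁ ∪ Q₂ ∪ {x})).Connected) :
    ∃ q ∈ Q₁, G.Adj q x := by
  obtain ⟨q, hq⟩ := hQ₁.nonempty
  obtain ⟨p⟩ := hconn.preconnected ⟨q, .inl (.inl hq)⟩ ⟨x, .inr rfl⟩
  obtain ⟨d, -, hfst, hsnd⟩ := p.exists_boundary_dart {v | v.1 ∈ Q₁} hq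
    fun h => hQ₁.notMem h hx
  have hadj : G.Adj d.fst.1 d.snd.1 := d.adj
  obtain (h | h) | h := d.snd.2
  · exact absurd h hsnd
  · exact absurd (hQ₁.mem_of_adj hfst hadj (hQ₂.notMem h)) hsnd
  · rw [Set.mem_singleton_iff.mp h] at hadj
    exact ⟨_, hfst, hadj⟩

/-- In a graph of maximum degree two in which at most one vertex of `Sᶜ` has no neighbor in `S`,
a gap of `S` has at most two vertices, or at most three if it contains that vertex. -/
theorem ncard_le (hQ : IsGap G S Q)
    (hdeg : ∀ v, ∃ a b, ∀ w, G.Adj v w ↔ w = a ∨ w = b)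
    (huniq : ∀ u v, u ∉ S → v ∉ S → (∀ w ∈ S, ¬ G.Adj u w) → (∀ w ∈ S, ¬ G.Adj v w) → u = v) :
    Q.ncard ≤ 2 ∨ Q.ncard ≤ 3 ∧ ∃ u ∈ Q, ∀ w ∈ S, ¬ G.Adj u w := by
  have hside : ∀ u ∉ S, ∀ v, G.Adj u v → (∃ w ∈ S, G.Adj v w) →
      ∀ w, G.Adj v w → w ∉ S → w = u := by
    rintro u hu v huv ⟨z, hz, hvz⟩ w hvw hw
    obtain ⟨a, b, hab⟩ := hdeg v
    have h₁ := (hab u).mp huv.symm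
    have h₂ := (hab z).mp hvz
    have h₃ := (hab w).mp hvw
    grind
  by_cases hfar : ∃ u ∈ Q, ∀ w ∈ S, ¬ G.Adj u w
  · refine .inr ⟨?_, hfar⟩
    obtain ⟨u, hu, hfar⟩ := hfar
    obtain ⟨a, b, hab⟩ := hdeg u
    have hclosed : ∀ v, G.Adj u v → ∀ w, G.Adj v w → w ∉ S → w = u := by
      intro v huv
      refine hside u (hQ.notMem hu) v huv ?_
      by_contra! h
      exact huv.ne (huniq u v (hQ.notMem hu) (fun hv => hfar v hv huv) hfar h)
    have hsub : Q ⊆ {u, a, b} := hQ.subset_of_closed hu (by simp) <| by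
      rintro v (rfl | hv) w hvw hw
      · exact .inr ((hab w).mp hvw)
      · exact .inl (hclosed v ((hab v).mpr hv) w hvw hw)
    exact (Set.ncard_le_ncard hsub (by simp)).trans
      ((Set.ncard_insert_le _ _).trans (Nat.succ_le_succ ((Set.ncard_insert_le _ _).trans (by simp))))
  · left
    push Not at hfar
    obtain ⟨q, hq⟩ := hQ.nonempty
    obtain ⟨a, b, hab⟩ := hdeg q
    have hr : ∃ r, ∀ w, G.Adj q w → w ∉ S → w = r := by
      obtain ⟨z, hz, hqz⟩ := hfar q hq
      by_cases ha : a ∈ S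
      · exact ⟨b, fun w hw hwS => ((hab w).mp hw).resolve_left fun h => hwS (h ▸ ha)⟩
      · refine ⟨a, fun w hw hwS => ((hab w).mp hw).resolve_right fun h => hwS ?_⟩
        have := (hab z).mp hqz
        grind
    obtain ⟨r, hr⟩ := hr
    have hsub : Q ⊆ insert q {v | v = r ∧ v ∈ Q ∧ G.Adj q v} :=
      hQ.subset_of_closed hq (by simp) <| by
        rintro v (rfl | ⟨-, hvQ, hqv⟩) w hvw hw
        · exact .inr ⟨hr w hvw hw, hQ.mem_of_adj hq hvw hw, hvw⟩
        · exact .inl (hside q (hQ.notMem hq) v hqv (hfar v hvQ) w hvw hw)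
    have hsub' : Q ⊆ {q, r} := hsub.trans (Set.insert_subset_insert fun v hv => hv.1)
    exact (Set.ncard_le_ncard hsub' (by simp)).trans ((Set.ncard_insert_le _ _).trans (by simp))

end IsGap

theorem exists_cycleGraph_adj_iff {m : ℕ} (hm : 2 ≤ m) (v : Fin m) :
    ∃ a b, ∀ w, (cycleGraph m).Adj v w ↔ w = a ∨ w = b := by
  obtain ⟨n, rfl⟩ := Nat.exists_eq_add_of_le' hm
  refine ⟨v - 1, v + 1, fun w => ?_⟩
  rw [cycleGraph_adj]
  grind

/-- Observation on the gaps of an adjacency basis of the cycle `C_m`. -/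
theorem gaps_of_adjBasis_cycleGraph (m : ℕ) (hm : 4 ≤ m) (B : Finset (Fin m))
    (hB : IsAdjBasis (cycleGraph m) B) :
    (∀ Q : Set (Fin m), IsGap (cycleGraph m) ↑B Q → Q.ncard ≤ 3) ∧
    (∀ Q₁ Q₂ : Set (Fin m), IsGap (cycleGraph m) ↑B Q₁ → IsGap (cycleGraph m) ↑B Q₂ →
      Q₁.ncard = 3 → Q₂.ncard = 3 → Q₁ = Q₂) ∧
    (∀ Q₁ Q₂ : Set (Fin m), IsGap (cycleGraph m) ↑B Q₁ → IsGap (cycleGraph m) ↑B Q₂ →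
      2 ≤ Q₁.ncard → NeighboringGaps (cycleGraph m) ↑B Q₁ Q₂ → Q₂.ncard = 1) := by
  obtain ⟨hres, -⟩ := hB
  have hconn : (cycleGraph m).Connected := by
    obtain ⟨n, rfl⟩ := Nat.exists_eq_add_of_le' (show 1 ≤ m by omega)
    exact cycleGraph_connected
  have hdeg := exists_cycleGraph_adj_iff (show 2 ≤ m by omega)
  have huniq : ∀ u v, u ∉ (B : Set (Fin m)) → v ∉ (B : Set (Fin m)) →
      (∀ w ∈ (B : Set (Fin m)), ¬ (cycleGraph m).Adj u w) →
      (∀ w ∈ (B : Set (Fin m)), ¬ (cycleGraph m).Adj v w) → u = v :=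
    fun u v hu hv hu' hv' => hres.eq_of_adj_iff hconn hu hv
      fun w hw => iff_of_false (hu' w hw) (hv' w hw)
  refine ⟨fun Q hQ => ?_, fun Q₁ Q₂ hQ₁ hQ₂ h₁ h₂ => ?_, ?_⟩
  · have := hQ.ncard_le hdeg huniq
    omega
  · obtain ⟨-, u, hu, hu'⟩ := (hQ₁.ncard_le hdeg huniq).resolve_left (by omega)
    obtain ⟨-, v, hv, hv'⟩ := (hQ₂.ncard_le hdeg huniq).resolve_left (by omega)
    obtain rfl := huniq u v (hQ₁.notMem hu) (hQ₂.notMem hv) hu' hv'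
    exact hQ₁.eq_of_mem hQ₂ hu hv
  · rintro Q₁ Q₂ hQ₁ hQ₂ h₁ ⟨hne, x, hx, hx'⟩
    by_contra h₂
    have hpos : 0 < Q₂.ncard := (Set.ncard_pos).mpr hQ₂.nonempty
    have hborder : ∀ Q, IsGap (cycleGraph m) ↑B Q → 2 ≤ Q.ncard → ∀ q ∈ Q,
        (cycleGraph m).Adj q x → ∀ w ∈ (B : Set (Fin m)), (cycleGraph m).Adj q w ↔ w = x := by
      intro Q hQ hcard q hq hqx w hw
      obtain ⟨r, hr, hqr⟩ := hQ.exists_adj_mem hcard hq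
      have hrB := hQ.notMem hr
      obtain ⟨a, b, hab⟩ := hdeg q
      have hr' := (hab r).mp hqr
      have hx' := (hab x).mp hqx
      rw [hab w]
      grind
    obtain ⟨q₁, hq₁, hadj₁⟩ := hQ₁.exists_adj_of_connected hQ₂ hx hx'
    obtain ⟨q₂, hq₂, hadj₂⟩ := hQ₂.exists_adj_of_connected hQ₁ hx
      (by rwa [Set.union_comm Q₂ Q₁])
    obtain rfl : q₁ = q₂ := hres.eq_of_adj_iff hconn (hQ₁.notMem hq₁) (hQ₂.notMem hq₂)
      fun w hw => (hborder Q₁ hQ₁ h₁ q₁ hq₁ hadj₁ w hw).trans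
        (hborder Q₂ hQ₂ (by omega) q₂ hq₂ hadj₂ w hw).symm
    exact hne (hQ₁.eq_of_mem hQ₂ hq₁ hq₂)
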